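/- Let (M, τ) be a tracial W*-probability space and D ⊂ M a finite-dimensional unital *-subalgebra with a conditional expectation E: M → D such that τ∘E = τ. Let X_1,…,X_m, Y_1,…,Y_n ∈ M be selfadjoint with Φ*(X_1,…,X_m,Y_1,…,Y_n : D) < ∞. Then the following are equivalent: (i) Φ*(X_1,…,X_m,Y_1,…,Y_n : D) = Φ*(X_1,…,X_m : D) + Φ*(Y_1,…,Y_n : D); (ii) {X_1,…,X_m} and {Y_1,…,Y_n} are free with amalgamation over D. -/

import Mathlib

/-!  Statement 18 (Corollary 6.3):  for finite-dimensional `D` and selfadjoint `X₁,…,X_m, Y₁,…,Yₙ` with `Φ*(X,Y : D) < ∞`, additivity of the free Fisher information, `Φ*(X,Y:D) = Φ*(X:D) + Φ*(Y:D)`, holds iff `{X₁,…,X_m}` and `{Y₁,…,Yₙ}` are free with amalgamation over `D`. -/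

open scoped Classical ENNReal

noncomputable section

namespace OVD

variable {M : Type*} [Ring M] [Algebra ℂ M] [StarRing M] [StarModule ℂ M]

/-- `τ` is a faithful tracial state on the complex `*`-algebra `M`
(the normality and von Neumann algebra structure of a tracial
`W*`-probability space are not used in the algebraic statement). -/
structure IsFaithfulTracialState [StarRing M] (τ : M →ₗ[ℂ] ℂ) : Prop where
  unital : τ 1 = 1
  tracial : ∀ x y, τ (x * y) = τ (y * x)
  pos : ∀ x, 0 ≤ (τ (star x * x)).re ∧ (τ (star x * x)).im = 0
  faithful : ∀ x, τ (star x * x) = 0 → x = 0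

/-- `E : M → M` is a conditional expectation onto the unital subalgebra `B`. -/
def IsCondExp (B : Subalgebra ℂ M) (E : M →ₗ[ℂ] M) : Prop :=
  E 1 = 1 ∧ (∀ x, E x ∈ B) ∧ ∀ b ∈ B, ∀ b' ∈ B, ∀ x, E (b * x * b') = b * E x * b'

/-- Two subsets `S₁, S₂` of `A` (each thought of as a subalgebra containing the
base algebra) are free with amalgamation with respect to the conditional
expectation `E` (valued in the module `W`):  every alternating product of
`E`-centered elements is `E`-centered. -/
def IsFreeWithAmalgamation {A W : Type*} [Ring A] [Algebra ℂ A]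
    [AddCommGroup W] [Module ℂ W] (E : A →ₗ[ℂ] W) (S₁ S₂ : Set A) : Prop :=
  ∀ (k : ℕ), 0 < k → ∀ (a : Fin k → A) (f : Fin k → Bool),
    (∀ j, a j ∈ (if f j then S₁ else S₂)) →
    (∀ j, E (a j) = 0) →
    (∀ (j : ℕ) (h : j + 1 < k), f ⟨j, Nat.lt_of_succ_lt h⟩ ≠ f ⟨j + 1, h⟩) →
    E ((List.ofFn a).prod) = 0

/-- the `L²`-distance with respect to the trace `τ`: `‖x − y‖₂`. -/
def l2Dist [StarRing M] (τ : M →ₗ[ℂ] ℂ) (x y : M) : ℝ :=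
  Real.sqrt ((τ ((x - y) * star (x - y))).re)

/-- `x` belongs to `L²(S)`, the `‖·‖₂`-closure of the (star-)algebra
generated by `S`, (intersected with `M`; conjugate variables and liberation
gradients are modelled as elements of `M` here). -/
def MemL2Closure [StarRing M] (τ : M →ₗ[ℂ] ℂ) (S : Set M) (x : M) : Prop :=
  ∀ ε : ℝ, 0 < ε → ∃ a ∈ Algebra.adjoin ℂ (S ∪ star '' S), l2Dist τ x a < ε

/-- the word `b₁ X_{i₁} b₂ X_{i₂} ⋯ b_m X_{i_m} b_{m+1}`. -/
def altWord {n : ℕ} (X : Fin n → M) {m : ℕ} (b : Fin (m + 1) → M)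
    (idx : Fin m → Fin n) : M :=
  (List.ofFn fun j : Fin m => b j.castSucc * X (idx j)).prod * b (Fin.last m)

/-- the initial segment `b₁ X_{i₁} ⋯ b_{r-1} X_{i_{r-1}} b_r` of an
alternating word (`r` is `0`-indexed). -/
def altWordBefore {n : ℕ} (X : Fin n → M) {m : ℕ} (b : Fin (m + 1) → M)
    (idx : Fin m → Fin n) (r : Fin m) : M :=
  (((List.finRange m).filter fun s : Fin m => decide ((s : ℕ) < (r : ℕ))).map
      fun j => b j.castSucc * X (idx j)).prod * b r.castSucc

/-- the final segment `b_{r+1} X_{i_{r+1}} ⋯ b_m X_{i_m} b_{m+1}` of an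
alternating word (`r` is `0`-indexed). -/
def altWordAfter {n : ℕ} (X : Fin n → M) {m : ℕ} (b : Fin (m + 1) → M)
    (idx : Fin m → Fin n) (r : Fin m) : M :=
  (((List.finRange m).filter fun s : Fin m => decide ((r : ℕ) < (s : ℕ))).map
      fun j => b j.castSucc * X (idx j)).prod * b (Fin.last m)

/-- the defining equations of the conjugate variables `J_i = J_i(X₁,…,Xₙ : B)`:
`τ(J_i b₁ X_{i₁} ⋯ b_m X_{i_m} b_{m+1}) = ∑_r δ_{i i_r} τ(b₁ X_{i₁} ⋯ b_r) ·
τ(b_{r+1} X_{i_{r+1}} ⋯ b_{m+1})` for all `m ≥ 0` and `b₁,…,b_{m+1} ∈ B`. -/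
def ConjugateEquations (τ : M →ₗ[ℂ] ℂ) (B : Subalgebra ℂ M) {n : ℕ}
    (X J : Fin n → M) : Prop :=
  ∀ (i : Fin n) (m : ℕ) (b : Fin (m + 1) → M) (idx : Fin m → Fin n),
    (∀ j, b j ∈ B) →
    τ (J i * altWord X b idx) =
      ∑ r : Fin m, (if idx r = i then (1 : ℂ) else 0) *
        τ (altWordBefore X b idx r) * τ (altWordAfter X b idx r)

/-- `J` is the system of conjugate variables of `X₁,…,Xₙ` with respect to `B`. -/
def IsConjugateSystem [StarRing M] (τ : M →ₗ[ℂ] ℂ) (B : Subalgebra ℂ M) {n : ℕ}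
    (X J : Fin n → M) : Prop :=
  (∀ i, MemL2Closure τ ((B : Set M) ∪ Set.range X) (J i)) ∧
    ConjugateEquations τ B X J

/-- the relative free Fisher information `Φ*(X₁,…,Xₙ : B)`; it equals
`∑ᵢ ‖Jᵢ‖₂²` if a conjugate system `J` exists and `∞` otherwise. -/
def phiStar [StarRing M] (τ : M →ₗ[ℂ] ℂ) (B : Subalgebra ℂ M) {n : ℕ}
    (X : Fin n → M) : ℝ≥0∞ :=
  sInf {r : ℝ≥0∞ | ∃ J : Fin n → M, IsConjugateSystem τ B X J ∧
    r = ∑ i, ENNReal.ofReal ((τ (J i * star (J i))).re)}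

set_option linter.unusedSectionVars false

open scoped TensorProduct ComplexConjugate

section Trace

variable {τ : M →ₗ[ℂ] ℂ}

theorem IsFaithfulTracialState.map_star (hτ : IsFaithfulTracialState τ) (x : M) :
    τ (star x) = conj (τ x) := by
  have h0 := (hτ.pos x).2
  have h1 := (hτ.pos 1).2
  have h2 := (hτ.pos (x + 1)).2
  have h3 := (hτ.pos (x + Complex.I • (1 : M))).2
  simp [add_mul, mul_add, star_add, star_smul, hτ.unital, Complex.mul_im]
    at h0 h1 h2 h3
  apply Complex.ext
  · simp; linarith
  · simp; linarith

theorem IsFaithfulTracialState.mul_self_re_nonneg (hτ : IsFaithfulTracialState τ) (x : M) :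
    0 ≤ (τ (x * star x)).re := by
  rw [hτ.tracial]
  exact (hτ.pos x).1

theorem IsFaithfulTracialState.eq_zero_of_re_eq_zero (hτ : IsFaithfulTracialState τ) {x : M}
    (h : (τ (x * star x)).re = 0) : x = 0 := by
  rw [hτ.tracial] at h
  exact hτ.faithful x (Complex.ext h (hτ.pos x).2)

/-- The positive semidefinite form `⟪x, y⟫ = τ(x* y)`. -/
abbrev IsFaithfulTracialState.preInnerCore (hτ : IsFaithfulTracialState τ) :
    PreInnerProductSpace.Core ℂ M where
  inner x y := τ (star x * y)
  conj_inner_symm x y := by rw [← hτ.map_star]; simp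
  re_inner_nonneg x := (hτ.pos x).1
  add_left x y z := by simp [add_mul]
  smul_left x y r := by simp [star_smul]

theorem IsFaithfulTracialState.norm_sq_le (hτ : IsFaithfulTracialState τ) (x y : M) :
    ‖τ (x * y)‖ ^ 2 ≤ (τ (x * star x)).re * (τ (y * star y)).re := by
  let _ := hτ.preInnerCore
  have h := InnerProductSpace.Core.inner_mul_inner_self_le (𝕜 := ℂ) (star x) y
  change ‖τ (star (star x) * y)‖ * ‖τ (star y * star x)‖ ≤
    (τ (star (star x) * star x)).re * (τ (star y * y)).re at h
  rw [star_star, ← star_mul, hτ.map_star, RCLike.norm_conj, hτ.tracial (star y)] at h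
  rwa [sq]

/-- An element annihilating the algebra generated by `S` annihilates `L²(S)`. -/
theorem MemL2Closure.map_mul_eq_zero (hτ : IsFaithfulTracialState τ) {S : Set M} {J x : M}
    (hJ : MemL2Closure τ S J)
    (hx : ∀ a ∈ Algebra.adjoin ℂ (S ∪ star '' S), τ (x * a) = 0) : τ (x * J) = 0 := by
  by_contra hne
  have hpos : 0 < ‖τ (x * J)‖ := norm_pos_iff.2 hne
  set c := Real.sqrt (τ (x * star x)).re with hc
  have hc0 : 0 ≤ c := Real.sqrt_nonneg _
  obtain ⟨a, ha, hlt⟩ := hJ (‖τ (x * J)‖ / (c + 1)) (by positivity)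
  have h := hτ.norm_sq_le x (J - a)
  rw [mul_sub, map_sub, hx a ha, sub_zero] at h
  have h2 : ‖τ (x * J)‖ ≤ c * l2Dist τ J a := by
    rw [hc, l2Dist, ← Real.sqrt_mul (hτ.mul_self_re_nonneg x)]
    exact Real.le_sqrt_of_sq_le h
  have h3 : c * l2Dist τ J a ≤ c * (‖τ (x * J)‖ / (c + 1)) :=
    mul_le_mul_of_nonneg_left hlt.le hc0
  have h4 : c * (‖τ (x * J)‖ / (c + 1)) < ‖τ (x * J)‖ := by
    rw [mul_div_assoc', div_lt_iff₀ (by positivity)]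
    nlinarith
  linarith

/-- If `b` is orthogonal to `J - a`, then approximation by `a` is no worse than by `a + b`. -/
theorem l2Dist_le_of_orthogonal (hτ : IsFaithfulTracialState τ) {J a b : M}
    (h : τ ((J - a) * star b) = 0) : l2Dist τ J a ≤ l2Dist τ J (a + b) := by
  refine Real.sqrt_le_sqrt ?_
  have h' : τ (b * star (J - a)) = 0 := by
    rw [← star_star b, ← star_mul, hτ.map_star, h, map_zero]
  have hb := hτ.mul_self_re_nonneg b
  have e : (J - (a + b)) * star (J - (a + b)) = (J - a) * star (J - a) - (J - a) * star b
      - b * star (J - a) + b * star b := by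
    simp only [star_sub, star_add]; noncomm_ring
  rw [e]
  simp only [map_add, map_sub, h, h', Complex.add_re, Complex.sub_re, Complex.zero_re]
  linarith

end Trace

section ConjugateSystems

variable {τ : M →ₗ[ℂ] ℂ} {D : Subalgebra ℂ M} {N : ℕ} {Z J J' : Fin N → M}

theorem star_mem_adjoin_of_star_mem {S : Set M} (hS : ∀ x ∈ S, star x ∈ S) {a : M}
    (ha : a ∈ Algebra.adjoin ℂ S) : star a ∈ Algebra.adjoin ℂ S := by
  induction ha using Algebra.adjoin_induction with
  | mem x hx => exact Algebra.subset_adjoin (hS x hx)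
  | algebraMap r =>
    rw [Algebra.algebraMap_eq_smul_one, star_smul, star_one]
    exact Subalgebra.smul_mem _ (one_mem _) _
  | add x y _ _ hx hy => rw [star_add]; exact add_mem hx hy
  | mul x y _ _ hx hy => rw [star_mul]; exact mul_mem hy hx

theorem union_star_image_eq {S : Set M} (hS : ∀ x ∈ S, star x ∈ S) : S ∪ star '' S = S := by
  refine Set.union_eq_left.2 ?_
  rintro _ ⟨x, hx, rfl⟩
  exact hS x hx

theorem star_mem_coeff_union_range (hD : ∀ d ∈ D, star d ∈ D) (hZ : ∀ i, IsSelfAdjoint (Z i)) :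
    ∀ x ∈ (D : Set M) ∪ Set.range Z, star x ∈ (D : Set M) ∪ Set.range Z := by
  rintro x (hx | ⟨i, rfl⟩)
  · exact Or.inl (hD x hx)
  · exact Or.inr ⟨i, (hZ i).star_eq.symm⟩

theorem adjoin_coeff_union (D : Subalgebra ℂ M) (S : Set M) :
    Algebra.adjoin ℂ ((D : Set M) ∪ S) = D ⊔ Algebra.adjoin ℂ S := by
  rw [Algebra.adjoin_union, Algebra.adjoin_eq]

end ConjugateSystems

section FreeDifferenceQuotients

variable {τ : M →ₗ[ℂ] ℂ} {D : Subalgebra ℂ M} {N : ℕ} {Z J : Fin N → M}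

/-- `IsDiff D Z w t`: the family `t` of tensors is the family of free difference quotients
`∂_i w` of some expression of `w` as a polynomial in the `Z_i` with coefficients in `D`. -/
inductive IsDiff (D : Subalgebra ℂ M) {N : ℕ} (Z : Fin N → M) :
    M → (Fin N → M ⊗[ℂ] M) → Prop
  | coeff {d : M} (hd : d ∈ D) : IsDiff D Z d 0
  | gen (k : Fin N) : IsDiff D Z (Z k) (fun i => if k = i then 1 ⊗ₜ 1 else 0)
  | add {w w' : M} {t t' : Fin N → M ⊗[ℂ] M} (h : IsDiff D Z w t) (h' : IsDiff D Z w' t') :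
      IsDiff D Z (w + w') (t + t')
  | mul {w w' : M} {t t' : Fin N → M ⊗[ℂ] M} (h : IsDiff D Z w t) (h' : IsDiff D Z w' t') :
      IsDiff D Z (w * w') (fun i => t i * (1 ⊗ₜ w') + (w ⊗ₜ 1) * t' i)

/-- The free difference quotients of an alternating word. -/
def altWordDiff (Z : Fin N → M) {m : ℕ} (b : Fin (m + 1) → M) (idx : Fin m → Fin N) :
    Fin N → M ⊗[ℂ] M :=
  fun i => ∑ r : Fin m, if idx r = i then
    altWordBefore Z b idx r ⊗ₜ[ℂ] altWordAfter Z b idx r else 0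

theorem altWord_cons {m : ℕ} (d : M) (b : Fin (m + 1) → M) (k : Fin N) (idx : Fin m → Fin N) :
    altWord Z (Fin.cons d b : Fin (m + 2) → M) (Fin.cons k idx : Fin (m + 1) → Fin N) =
      d * Z k * altWord Z b idx := by
  simp [altWord, List.ofFn_succ, mul_assoc, ← Fin.succ_last]

theorem altWordBefore_cons_zero {m : ℕ} (d : M) (b : Fin (m + 1) → M) (k : Fin N)
    (idx : Fin m → Fin N) :
    altWordBefore Z (Fin.cons d b : Fin (m + 2) → M) (Fin.cons k idx : Fin (m + 1) → Fin N) 0 =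
      d := by
  simp [altWordBefore]

theorem altWordAfter_cons_zero {m : ℕ} (d : M) (b : Fin (m + 1) → M) (k : Fin N)
    (idx : Fin m → Fin N) :
    altWordAfter Z (Fin.cons d b : Fin (m + 2) → M) (Fin.cons k idx : Fin (m + 1) → Fin N) 0 =
      altWord Z b idx := by
  simp [altWordAfter, altWord, List.finRange_succ, List.filter_map, Function.comp_def,
    ← Fin.succ_last, List.ofFn_eq_map]

theorem altWordBefore_cons_succ {m : ℕ} (d : M) (b : Fin (m + 1) → M) (k : Fin N)
    (idx : Fin m → Fin N) (r : Fin m) :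
    altWordBefore Z (Fin.cons d b : Fin (m + 2) → M) (Fin.cons k idx : Fin (m + 1) → Fin N)
      r.succ = d * Z k * altWordBefore Z b idx r := by
  simp [altWordBefore, List.finRange_succ, List.filter_map, Function.comp_def, mul_assoc]

theorem altWordAfter_cons_succ {m : ℕ} (d : M) (b : Fin (m + 1) → M) (k : Fin N)
    (idx : Fin m → Fin N) (r : Fin m) :
    altWordAfter Z (Fin.cons d b : Fin (m + 2) → M) (Fin.cons k idx : Fin (m + 1) → Fin N)
      r.succ = altWordAfter Z b idx r := by
  simp [altWordAfter, List.finRange_succ, List.filter_map, Function.comp_def, ← Fin.succ_last]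

theorem altWordDiff_cons {m : ℕ} (d : M) (b : Fin (m + 1) → M) (k : Fin N)
    (idx : Fin m → Fin N) (i : Fin N) :
    altWordDiff Z (Fin.cons d b : Fin (m + 2) → M) (Fin.cons k idx : Fin (m + 1) → Fin N) i =
      (if k = i then d ⊗ₜ altWord Z b idx else 0) +
        ((d * Z k) ⊗ₜ 1) * altWordDiff Z b idx i := by
  simp only [altWordDiff, Fin.sum_univ_succ, Fin.cons_zero, Fin.cons_succ,
    altWordBefore_cons_zero, altWordAfter_cons_zero, altWordBefore_cons_succ,
    altWordAfter_cons_succ, Finset.mul_sum, mul_ite, mul_zero,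
    Algebra.TensorProduct.tmul_mul_tmul, one_mul]

/-- The span of the alternating words paired with their free difference quotients. -/
def altWordGraph (D : Subalgebra ℂ M) (Z : Fin N → M) :
    Submodule ℂ (M × (Fin N → M ⊗[ℂ] M)) :=
  Submodule.span ℂ {x | ∃ (m : ℕ) (b : Fin (m + 1) → M) (idx : Fin m → Fin N),
    (∀ j, b j ∈ D) ∧ x = (altWord Z b idx, altWordDiff Z b idx)}

theorem altWord_mem_altWordGraph {m : ℕ} {b : Fin (m + 1) → M} (hb : ∀ j, b j ∈ D)
    (idx : Fin m → Fin N) : (altWord Z b idx, altWordDiff Z b idx) ∈ altWordGraph D Z :=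
  Submodule.subset_span ⟨m, b, idx, hb, rfl⟩

theorem coeff_mul_mem_altWordGraph {d : M} (hd : d ∈ D) {x : M × (Fin N → M ⊗[ℂ] M)}
    (hx : x ∈ altWordGraph D Z) :
    (d * x.1, fun i => (d ⊗ₜ 1) * x.2 i) ∈ altWordGraph D Z := by
  induction hx using Submodule.span_induction with
  | mem x h =>
    obtain ⟨m, b, idx, hb, rfl⟩ := h
    cases m with
    | zero =>
      have e : (d * altWord Z b idx, fun i => (d ⊗ₜ[ℂ] (1 : M)) * altWordDiff Z b idx i) =
          (altWord Z (fun _ => d * b 0) idx, altWordDiff Z (fun _ => d * b 0) idx) := by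
        ext <;> simp [altWord, altWordDiff]
      exact e ▸ altWord_mem_altWordGraph (fun _ => mul_mem hd (hb 0)) idx
    | succ m =>
      obtain ⟨b0, b, rfl⟩ : ∃ b0 b', b = Fin.cons b0 b' := ⟨_, _, (Fin.cons_self_tail b).symm⟩
      obtain ⟨k, idx, rfl⟩ : ∃ k idx', idx = Fin.cons k idx' :=
        ⟨_, _, (Fin.cons_self_tail idx).symm⟩
      have hb0 : b0 ∈ D := by simpa using hb 0
      have hb' : ∀ j, b j ∈ D := fun j => by simpa using hb j.succ
      convert altWord_mem_altWordGraph (D := D) (Z := Z) (b := Fin.cons (d * b0) b)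
        (fun j => Fin.cases (by simpa using mul_mem hd hb0) (by simpa using hb') j)
        (Fin.cons k idx) using 1
      ext i
      · simp [altWord_cons, mul_assoc]
      · simp only [altWordDiff_cons, mul_add, mul_ite, mul_zero,
          Algebra.TensorProduct.tmul_mul_tmul, one_mul, ← mul_assoc]
  | zero => convert Submodule.zero_mem _ using 1; ext <;> simp
  | add x y _ _ hx hy => convert add_mem hx hy using 1; ext <;> simp [mul_add]
  | smul c x _ hx => convert Submodule.smul_mem _ c hx using 1; ext <;> simp

theorem gen_mul_mem_altWordGraph (k : Fin N) {x : M × (Fin N → M ⊗[ℂ] M)}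
    (hx : x ∈ altWordGraph D Z) :
    (Z k * x.1, fun i => (if k = i then 1 ⊗ₜ x.1 else 0) + (Z k ⊗ₜ 1) * x.2 i) ∈
      altWordGraph D Z := by
  induction hx using Submodule.span_induction with
  | mem x h =>
    obtain ⟨m, b, idx, hb, rfl⟩ := h
    convert altWord_mem_altWordGraph (D := D) (Z := Z) (b := Fin.cons 1 b)
      (fun j => Fin.cases (by simp [one_mem]) (by simpa using hb) j)
      (Fin.cons k idx) using 1
    ext i
    · simp [altWord_cons]
    · simp [altWordDiff_cons]
  | zero => convert Submodule.zero_mem _ using 1; ext <;> simp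
  | add x y _ _ hx hy =>
    convert add_mem hx hy using 1
    ext i
    · simp [mul_add]
    · by_cases h : k = i <;> simp [h, mul_add, TensorProduct.tmul_add] ; abel
  | smul c x _ hx =>
    convert Submodule.smul_mem _ c hx using 1
    ext i
    · simp
    · by_cases h : k = i <;> simp [h]

theorem IsDiff.mul_mem_altWordGraph {w : M} {t : Fin N → M ⊗[ℂ] M} (h : IsDiff D Z w t) :
    ∀ x ∈ altWordGraph D Z,
      (w * x.1, fun i => t i * (1 ⊗ₜ x.1) + (w ⊗ₜ 1) * x.2 i) ∈ altWordGraph D Z := by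
  induction h with
  | coeff hd => intro x hx; simpa using coeff_mul_mem_altWordGraph hd hx
  | gen k => intro x hx; simpa [ite_mul] using gen_mul_mem_altWordGraph k hx
  | add _ _ ih ih' =>
    intro x hx
    convert add_mem (ih x hx) (ih' x hx) using 1
    ext i
    · simp [add_mul]
    · simp [add_mul, TensorProduct.add_tmul]; abel
  | @mul w w' t t' _ _ ih ih' =>
    intro x hx
    convert ih _ (ih' x hx) using 1
    ext i
    · simp [mul_assoc]
    · simp only [add_mul, mul_add, mul_assoc, ← add_assoc]
      simp [← mul_assoc]

theorem IsDiff.mem_altWordGraph {w : M} {t : Fin N → M ⊗[ℂ] M} (h : IsDiff D Z w t) :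
    (w, t) ∈ altWordGraph D Z := by
  have h1 : ((1 : M), (0 : Fin N → M ⊗[ℂ] M)) ∈ altWordGraph D Z := by
    have e : ((1 : M), (0 : Fin N → M ⊗[ℂ] M)) =
        (altWord Z (fun _ : Fin 1 => (1 : M)) Fin.elim0,
          altWordDiff Z (fun _ : Fin 1 => (1 : M)) Fin.elim0) := by
      ext <;> simp [altWord, altWordDiff]
    exact e ▸ altWord_mem_altWordGraph (fun _ => one_mem D) _
  simpa [← Algebra.TensorProduct.one_def] using h.mul_mem_altWordGraph _ h1

/-- The product trace `τ ⊗ τ` on `M ⊗ M`. -/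
def tensorTrace (τ : M →ₗ[ℂ] ℂ) : M ⊗[ℂ] M →ₗ[ℂ] ℂ :=
  TensorProduct.lift ((LinearMap.mul ℂ ℂ).compl₁₂ τ τ)

@[simp]
theorem tensorTrace_tmul (u v : M) : tensorTrace τ (u ⊗ₜ v) = τ u * τ v := by
  simp [tensorTrace]

/-- The conjugate variable equations, in terms of free difference quotients. -/
theorem ConjugateEquations.map_mul (hJ : ConjugateEquations τ D Z J) {w : M}
    {t : Fin N → M ⊗[ℂ] M} (h : IsDiff D Z w t) (i : Fin N) :
    τ (J i * w) = tensorTrace τ (t i) := by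
  suffices H : ∀ x ∈ altWordGraph D Z, τ (J i * x.1) = tensorTrace τ (x.2 i) from
    H _ h.mem_altWordGraph
  intro x hx
  induction hx using Submodule.span_induction with
  | mem x h =>
    obtain ⟨m, b, idx, hb, rfl⟩ := h
    rw [hJ i m b idx hb]
    simp only [altWordDiff, map_sum]
    refine Finset.sum_congr rfl fun r _ => ?_
    split_ifs <;> simp
  | zero => simp
  | add x y _ _ hx hy => simp [mul_add, hx, hy]
  | smul c x _ hx => simp [hx]

theorem exists_isDiff {a : M} (ha : a ∈ D ⊔ Algebra.adjoin ℂ (Set.range Z)) :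
    ∃ t, IsDiff D Z a t := by
  rw [← adjoin_coeff_union] at ha
  induction ha using Algebra.adjoin_induction with
  | mem x hx =>
    obtain hx | ⟨k, rfl⟩ := hx
    · exact ⟨_, .coeff hx⟩
    · exact ⟨_, .gen k⟩
  | algebraMap r => exact ⟨_, .coeff (D.algebraMap_mem r)⟩
  | add x y _ _ hx hy =>
    obtain ⟨t, ht⟩ := hx
    obtain ⟨t', ht'⟩ := hy
    exact ⟨_, ht.add ht'⟩
  | mul x y _ _ hx hy =>
    obtain ⟨t, ht⟩ := hx
    obtain ⟨t', ht'⟩ := hy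
    exact ⟨_, ht.mul ht'⟩

end FreeDifferenceQuotients

section FisherInformation

variable {τ : M →ₗ[ℂ] ℂ} {D : Subalgebra ℂ M} {N : ℕ} {Z J J' : Fin N → M}

theorem ConjugateEquations.comp {m : ℕ} (hJ : ConjugateEquations τ D Z J) {σ : Fin m → Fin N}
    (hσ : Function.Injective σ) : ConjugateEquations τ D (Z ∘ σ) (J ∘ σ) := by
  intro i m b idx hb
  have h := hJ (σ i) m b (σ ∘ idx) hb
  simp only [Function.comp_apply, hσ.eq_iff] at h
  exact h

theorem mem_adjoin_coeff_union_star_iff (hD : ∀ d ∈ D, star d ∈ D)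
    (hZ : ∀ i, IsSelfAdjoint (Z i)) {a : M} :
    a ∈ Algebra.adjoin ℂ (((D : Set M) ∪ Set.range Z) ∪ star '' ((D : Set M) ∪ Set.range Z)) ↔
      a ∈ D ⊔ Algebra.adjoin ℂ (Set.range Z) := by
  rw [union_star_image_eq (star_mem_coeff_union_range hD hZ), adjoin_coeff_union]

theorem star_mem_sup_adjoin_range (hD : ∀ d ∈ D, star d ∈ D) (hZ : ∀ i, IsSelfAdjoint (Z i))
    {a : M} (ha : a ∈ D ⊔ Algebra.adjoin ℂ (Set.range Z)) :
    star a ∈ D ⊔ Algebra.adjoin ℂ (Set.range Z) := by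
  rw [← adjoin_coeff_union] at ha ⊢
  exact star_mem_adjoin_of_star_mem (star_mem_coeff_union_range hD hZ) ha

theorem ConjugateEquations.map_star_sub_mul_eq_zero (hτ : IsFaithfulTracialState τ)
    (hD : ∀ d ∈ D, star d ∈ D) (hZ : ∀ i, IsSelfAdjoint (Z i))
    (hJ : ConjugateEquations τ D Z J) (hJ' : ConjugateEquations τ D Z J') (i : Fin N) {x : M}
    (hx : MemL2Closure τ ((D : Set M) ∪ Set.range Z) x) : τ (star (J' i - J i) * x) = 0 := by
  refine hx.map_mul_eq_zero hτ fun a ha => ?_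
  rw [mem_adjoin_coeff_union_star_iff hD hZ] at ha
  obtain ⟨t, ht⟩ := exists_isDiff (star_mem_sup_adjoin_range hD hZ ha)
  have h : τ ((J' i - J i) * star a) = 0 := by
    rw [sub_mul, map_sub, hJ.map_mul ht, hJ'.map_mul ht, sub_self]
  rw [hτ.tracial, ← star_star a, ← star_mul, hτ.map_star, h, map_zero]

theorem IsConjugateSystem.unique (hτ : IsFaithfulTracialState τ)
    (hD : ∀ d ∈ D, star d ∈ D) (hZ : ∀ i, IsSelfAdjoint (Z i))
    (hJ : IsConjugateSystem τ D Z J) (hJ' : IsConjugateSystem τ D Z J') : J' = J := by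
  funext i
  have h1 := hJ.2.map_star_sub_mul_eq_zero hτ hD hZ hJ'.2 i (hJ.1 i)
  have h2 := hJ.2.map_star_sub_mul_eq_zero hτ hD hZ hJ'.2 i (hJ'.1 i)
  refine sub_eq_zero.1 (hτ.faithful _ ?_)
  rw [mul_sub, map_sub, h1, h2, sub_zero]

theorem IsConjugateSystem.phiStar_eq (hτ : IsFaithfulTracialState τ)
    (hD : ∀ d ∈ D, star d ∈ D) (hZ : ∀ i, IsSelfAdjoint (Z i))
    (hJ : IsConjugateSystem τ D Z J) :
    phiStar τ D Z = ENNReal.ofReal (∑ i, (τ (J i * star (J i))).re) := by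
  rw [ENNReal.ofReal_sum_of_nonneg fun i _ => hτ.mul_self_re_nonneg (J i)]
  have e : {r : ℝ≥0∞ | ∃ J : Fin N → M, IsConjugateSystem τ D Z J ∧
      r = ∑ i, ENNReal.ofReal ((τ (J i * star (J i))).re)} =
      {∑ i, ENNReal.ofReal ((τ (J i * star (J i))).re)} := by
    ext r
    constructor
    · rintro ⟨J', hJ', rfl⟩
      rw [hJ.unique hτ hD hZ hJ']
      rfl
    · rintro rfl
      exact ⟨J, hJ, rfl⟩
  rw [phiStar, e, sInf_singleton]

theorem exists_isConjugateSystem_of_phiStar_ne_top (h : phiStar τ D Z ≠ ⊤) :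
    ∃ J, IsConjugateSystem τ D Z J := by
  by_contra hne
  push Not at hne
  refine h ?_
  rw [phiStar, sInf_eq_top]
  rintro r ⟨J, hJ, -⟩
  exact (hne J hJ).elim

/-- Conjugate variables have minimal length among the solutions of the conjugate equations. -/
theorem IsConjugateSystem.re_map_mul_star_eq_add (hτ : IsFaithfulTracialState τ)
    (hD : ∀ d ∈ D, star d ∈ D) (hZ : ∀ i, IsSelfAdjoint (Z i))
    (hJ : IsConjugateSystem τ D Z J) (hJ' : ConjugateEquations τ D Z J') (i : Fin N) :
    (τ (J' i * star (J' i))).re =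
      (τ (J i * star (J i))).re + (τ ((J' i - J i) * star (J' i - J i))).re := by
  have h1 := hJ.2.map_star_sub_mul_eq_zero hτ hD hZ hJ' i (hJ.1 i)
  have h2 : τ (star (J i) * (J' i - J i)) = 0 := by
    rw [← star_star (J' i - J i), ← star_mul, hτ.map_star, h1, map_zero]
  have e : star (J' i) * J' i = star (J i) * J i + star (J' i - J i) * (J' i - J i)
      + star (J' i - J i) * J i + star (J i) * (J' i - J i) := by
    simp only [star_sub]; noncomm_ring
  rw [hτ.tracial, e, hτ.tracial (J i), hτ.tracial (J' i - J i)]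
  simp only [map_add, h1, h2, add_zero, Complex.add_re]

end FisherInformation

section ConditionalExpectation

variable {τ : M →ₗ[ℂ] ℂ} {D : Subalgebra ℂ M} {E : M →ₗ[ℂ] M}

theorem IsCondExp.map_coeff (hE : IsCondExp D E) {d : M} (hd : d ∈ D) : E d = d := by
  simpa [hE.1] using hE.2.2 d hd 1 (one_mem D) 1

theorem IsCondExp.map_coeff_mul (hE : IsCondExp D E) {d : M} (hd : d ∈ D) (x : M) :
    E (d * x) = d * E x := by
  simpa using hE.2.2 d hd 1 (one_mem D) x

theorem IsCondExp.map_mul_coeff (hE : IsCondExp D E) {d : M} (hd : d ∈ D) (x : M) :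
    E (x * d) = E x * d := by
  simpa using hE.2.2 1 (one_mem D) d hd x

theorem IsCondExp.map_sub_self (hE : IsCondExp D E) (x : M) : E (x - E x) = 0 := by
  rw [map_sub, hE.map_coeff (hE.2.1 x), sub_self]

theorem IsCondExp.trace_mul (hE : IsCondExp D E) (hEτ : ∀ x, τ (E x) = τ x) (x y : M) :
    τ (E x * E y) = τ (x * E y) := by
  rw [← hE.map_mul_coeff (hE.2.1 y), hEτ]

theorem IsCondExp.trace_mul' (hE : IsCondExp D E) (hEτ : ∀ x, τ (E x) = τ x) (x y : M) :
    τ (E x * E y) = τ (E x * y) := by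
  rw [← hE.map_coeff_mul (hE.2.1 x), hEτ]

/-- An element is centered as soon as all its products with coefficients are traceless. -/
theorem IsCondExp.eq_zero_of_trace (hE : IsCondExp D E) (hEτ : ∀ x, τ (E x) = τ x)
    (hτ : IsFaithfulTracialState τ) (hD : ∀ d ∈ D, star d ∈ D) {x : M}
    (h : ∀ d ∈ D, τ (d * x) = 0) : E x = 0 := by
  have hd := hD _ (hE.2.1 x)
  refine hτ.faithful _ ?_
  rw [← hE.map_coeff_mul hd, hEτ, h _ hd]

theorem IsCondExp.map_star (hE : IsCondExp D E) (hEτ : ∀ x, τ (E x) = τ x)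
    (hτ : IsFaithfulTracialState τ) (hD : ∀ d ∈ D, star d ∈ D) (x : M) :
    E (star x) = star (E x) := by
  have h : E (star x - star (E x)) = 0 := by
    refine hE.eq_zero_of_trace hEτ hτ hD fun d hd => ?_
    have h2 : τ ((x - E x) * star d) = 0 := by
      rw [← hEτ, hE.map_mul_coeff (hD d hd), hE.map_sub_self, zero_mul, map_zero]
    rw [← star_sub, ← star_star d, ← star_mul, hτ.map_star, h2, map_zero]
  rwa [map_sub, hE.map_coeff (hD _ (hE.2.1 x)), sub_eq_zero] at h

/-- The conditional expectation onto a finite-dimensional subalgebra in dual bases. -/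
theorem IsCondExp.exists_dual_basis [FiniteDimensional ℂ D] (hE : IsCondExp D E)
    (hEτ : ∀ x, τ (E x) = τ x) (hτ : IsFaithfulTracialState τ) (hD : ∀ d ∈ D, star d ∈ D) :
    ∃ (n : ℕ) (e f : Fin n → M), (∀ j, e j ∈ D) ∧ (∀ j, f j ∈ D) ∧
      ∀ x, E x = ∑ j, τ (f j * x) • e j := by
  let B : LinearMap.BilinForm ℂ D :=
    ((LinearMap.mul ℂ M).compr₂ τ).compl₁₂ D.val.toLinearMap D.val.toLinearMap
  have hB : ∀ x y : D, B x y = τ (x * y) := fun x y => rfl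
  have hnd : B.Nondegenerate := by
    refine ⟨fun x hx => ?_, fun x hx => ?_⟩
    · have := hx ⟨star (x : M), hD _ x.2⟩
      rw [hB, hτ.tracial] at this
      exact Subtype.ext (hτ.faithful _ this)
    · have := hx ⟨star (x : M), hD _ x.2⟩
      rw [hB] at this
      exact Subtype.ext (hτ.faithful _ this)
  let b := Module.finBasis ℂ D
  let f := B.dualBasis hnd b
  refine ⟨_, fun j => b j, fun j => f j, fun j => (b j).2, fun j => (f j).2, fun x => ?_⟩
  have key : ∀ j, τ (f j * x) = b.repr ⟨E x, hE.2.1 x⟩ j := by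
    intro j
    have h1 : τ (f j * x) = B (f j) ⟨E x, hE.2.1 x⟩ := by
      rw [hB, ← hEτ, hE.map_coeff_mul (f j).2]
    rw [h1]
    conv_lhs => rw [← b.sum_repr ⟨E x, hE.2.1 x⟩]
    simp only [f, map_sum, map_smul, LinearMap.BilinForm.apply_dualBasis_left, smul_eq_mul,
      mul_ite, mul_one, mul_zero, Finset.sum_ite_eq', Finset.mem_univ, if_true]
  have h2 := congrArg (Subtype.val : D → M) (b.sum_repr ⟨E x, hE.2.1 x⟩)
  simp only [key]
  simp only [AddSubmonoidClass.coe_finsetSum, SetLike.val_smul] at h2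
  exact h2.symm

end ConditionalExpectation

section Blocks

variable {τ : M →ₗ[ℂ] ℂ} {D : Subalgebra ℂ M} {E : M →ₗ[ℂ] M} {N : ℕ} {Z J : Fin N → M}
  {ty : Fin N → Bool}

/-- The algebra generated by `D` and the variables `Z_i` of colour `f`. -/
def blockAlgebra (D : Subalgebra ℂ M) (Z : Fin N → M) (ty : Fin N → Bool) (f : Bool) :
    Subalgebra ℂ M :=
  D ⊔ Algebra.adjoin ℂ (Z '' {i | ty i = f})

theorem coeff_le_blockAlgebra (f : Bool) : D ≤ blockAlgebra D Z ty f := le_sup_left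

theorem gen_mem_blockAlgebra (i : Fin N) : Z i ∈ blockAlgebra D Z ty (ty i) :=
  (le_sup_right : _ ≤ blockAlgebra D Z ty (ty i))
    (Algebra.subset_adjoin (Set.mem_image_of_mem _ rfl))

theorem star_mem_blockAlgebra (hD : ∀ d ∈ D, star d ∈ D) (hZ : ∀ i, IsSelfAdjoint (Z i))
    {f : Bool} {a : M} (ha : a ∈ blockAlgebra D Z ty f) : star a ∈ blockAlgebra D Z ty f := by
  rw [blockAlgebra, ← adjoin_coeff_union] at ha ⊢
  refine star_mem_adjoin_of_star_mem ?_ ha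
  rintro x (hx | ⟨i, hi, rfl⟩)
  · exact Or.inl (hD x hx)
  · exact Or.inr ⟨i, hi, (hZ i).star_eq.symm⟩

/-- The functional `u ⊗ v ↦ τ(E(p u z) E(v q)) - τ(E(p u) E(z v q))`. -/
def cutForm (τ : M →ₗ[ℂ] ℂ) (E : M →ₗ[ℂ] M) (z p q : M) : M ⊗[ℂ] M →ₗ[ℂ] ℂ :=
  TensorProduct.lift
    ((((LinearMap.mul ℂ M).compr₂ τ).compl₁₂ E E).compl₁₂
        (LinearMap.mulRight ℂ z ∘ₗ LinearMap.mulLeft ℂ p) (LinearMap.mulRight ℂ q) -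
      (((LinearMap.mul ℂ M).compr₂ τ).compl₁₂ E E).compl₁₂
        (LinearMap.mulLeft ℂ p) (LinearMap.mulLeft ℂ z ∘ₗ LinearMap.mulRight ℂ q))

@[simp]
theorem cutForm_tmul (z p q u v : M) :
    cutForm τ E z p q (u ⊗ₜ v) =
      τ (E (p * u * z) * E (v * q)) - τ (E (p * u) * E (z * (v * q))) := by
  simp [cutForm]

theorem cutForm_mul_right (z p q w : M) (x : M ⊗[ℂ] M) :
    cutForm τ E z p q (x * (1 ⊗ₜ w)) = cutForm τ E z p (w * q) x := by
  induction x using TensorProduct.induction_on with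
  | zero => simp
  | tmul u v => simp [mul_assoc]
  | add x y hx hy => rw [add_mul, map_add, map_add, hx, hy]

theorem cutForm_mul_left (z p q w : M) (x : M ⊗[ℂ] M) :
    cutForm τ E z p q ((w ⊗ₜ 1) * x) = cutForm τ E z (p * w) q x := by
  induction x using TensorProduct.induction_on with
  | zero => simp
  | tmul u v => simp [mul_assoc]
  | add x y hx hy => rw [mul_add, map_add, map_add, hx, hy]

/-- The sum of the cut functionals over the variables of colour `true`. -/
def totalCut (τ : M →ₗ[ℂ] ℂ) (E : M →ₗ[ℂ] M) (Z : Fin N → M) (ty : Fin N → Bool) (p q : M)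
    (t : Fin N → M ⊗[ℂ] M) : ℂ :=
  ∑ i with ty i = true, cutForm τ E (Z i) p q (t i)

theorem totalCut_mul (p q w w' : M) (t t' : Fin N → M ⊗[ℂ] M) :
    totalCut τ E Z ty p q (fun i => t i * (1 ⊗ₜ w') + (w ⊗ₜ 1) * t' i) =
      totalCut τ E Z ty p (w' * q) t + totalCut τ E Z ty (p * w) q t' := by
  simp only [totalCut, map_add, cutForm_mul_right, cutForm_mul_left, Finset.sum_add_distrib]

theorem exists_isDiff_block (hE : IsCondExp D E) {f : Bool} {a : M}
    (ha : a ∈ blockAlgebra D Z ty f) :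
    ∃ t, IsDiff D Z a t ∧
      (∀ i, ∀ φ : M ⊗[ℂ] M →ₗ[ℂ] ℂ, (∀ u ∈ blockAlgebra D Z ty f,
        ∀ v ∈ blockAlgebra D Z ty f, φ (u ⊗ₜ v) = 0) → φ (t i) = 0) ∧
      (∀ i, ty i ≠ f → t i = 0) ∧
      ∀ p q, totalCut τ E Z ty p q t =
        if f = true then τ (E (p * a) * E q) - τ (E p * E (a * q)) else 0 := by
  have ha' := ha
  rw [blockAlgebra, ← adjoin_coeff_union] at ha'
  have hcoeff : ∀ d ∈ D, ∃ t, IsDiff D Z d t ∧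
      (∀ i, ∀ φ : M ⊗[ℂ] M →ₗ[ℂ] ℂ, (∀ u ∈ blockAlgebra D Z ty f,
        ∀ v ∈ blockAlgebra D Z ty f, φ (u ⊗ₜ v) = 0) → φ (t i) = 0) ∧
      (∀ i, ty i ≠ f → t i = 0) ∧
      ∀ p q, totalCut τ E Z ty p q t =
        if f = true then τ (E (p * d) * E q) - τ (E p * E (d * q)) else 0 := by
    intro d hd
    refine ⟨0, .coeff hd, fun i φ _ => by simp, fun i _ => rfl, fun p q => ?_⟩
    rw [hE.map_mul_coeff hd, hE.map_coeff_mul hd]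
    simp [totalCut, mul_assoc]
  clear ha
  induction ha' using Algebra.adjoin_induction with
  | mem x hx =>
    obtain hx | ⟨k, hk, rfl⟩ := hx
    · exact hcoeff x hx
    · have hk : ty k = f := hk
      refine ⟨_, .gen k, fun i φ hφ => ?_, fun i hi => ?_, fun p q => ?_⟩
      · split_ifs
        · exact hφ 1 (one_mem _) 1 (one_mem _)
        · exact map_zero φ
      · exact if_neg fun h : k = i => hi (by rw [← h, hk])
      · simp only [totalCut, apply_ite, map_zero, cutForm_tmul, mul_one, one_mul]
        cases f <;> simp [hk]
  | algebraMap r => exact hcoeff _ (D.algebraMap_mem r)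
  | add x y _ _ hx hy =>
    obtain ⟨t, ht, h1, h2, h3⟩ := hx
    obtain ⟨t', ht', h1', h2', h3'⟩ := hy
    refine ⟨_, ht.add ht', fun i φ hφ => ?_, fun i hi => ?_, fun p q => ?_⟩
    · simp [h1 i φ hφ, h1' i φ hφ]
    · simp [h2 i hi, h2' i hi]
    · have e : totalCut τ E Z ty p q (t + t') =
          totalCut τ E Z ty p q t + totalCut τ E Z ty p q t' := by
        simp [totalCut, Finset.sum_add_distrib]
      rw [e, h3, h3']
      split_ifs
      · simp only [mul_add, add_mul, map_add]; ring
      · simp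
  | mul x y hx' hy' hx hy =>
    obtain ⟨t, ht, h1, h2, h3⟩ := hx
    obtain ⟨t', ht', h1', h2', h3'⟩ := hy
    rw [adjoin_coeff_union] at hx' hy'
    refine ⟨_, ht.mul ht', fun i φ hφ => ?_, fun i hi => ?_, fun p q => ?_⟩
    · have e1 := h1 i (φ ∘ₗ LinearMap.mulRight ℂ ((1 : M) ⊗ₜ[ℂ] y)) fun u hu v hv => by
        simpa using hφ u hu _ (mul_mem hv hy')
      have e2 := h1' i (φ ∘ₗ LinearMap.mulLeft ℂ (x ⊗ₜ[ℂ] (1 : M))) fun u hu v hv => by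
        simpa using hφ _ (mul_mem hx' hu) v hv
      simp only [LinearMap.comp_apply, LinearMap.mulRight_apply, LinearMap.mulLeft_apply]
        at e1 e2
      rw [map_add, e1, e2, add_zero]
    · simp [h2 i hi, h2' i hi]
    · rw [totalCut_mul, h3, h3']
      split_ifs
      · simp only [mul_assoc]; ring
      · simp

/-- The `D`-averaged commutator `∑_{i, j} f_j [Z_i, J_i] e_j` over the variables of colour
`true`. -/
def averagedCommutator (Z J : Fin N → M) (ty : Fin N → Bool) {n : ℕ} (e f : Fin n → M) : M :=
  ∑ i with ty i = true, ∑ j, f j * (Z i * J i - J i * Z i) * e j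

theorem cutForm_one_one_eq (hE : IsCondExp D E) (hEτ : ∀ x, τ (E x) = τ x)
    (hτ : IsFaithfulTracialState τ) {n : ℕ} {e f : Fin n → M}
    (hef : ∀ x, E x = ∑ j, τ (f j * x) • e j) (z : M) (x : M ⊗[ℂ] M) :
    ∑ j, (tensorTrace τ ((e j ⊗ₜ 1) * (x * (1 ⊗ₜ (f j * z)))) -
      tensorTrace τ (((z * e j) ⊗ₜ 1) * (x * (1 ⊗ₜ f j)))) = -cutForm τ E z 1 1 x := by
  have hform : ∀ u v, τ (E u * E v) = ∑ j, τ (e j * u) * τ (v * f j) := by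
    intro u v
    rw [hE.trace_mul hEτ, hef v, Finset.mul_sum, map_sum]
    refine Finset.sum_congr rfl fun j _ => ?_
    rw [mul_smul_comm, map_smul, smul_eq_mul, hτ.tracial u, hτ.tracial v, mul_comm]
  induction x using TensorProduct.induction_on with
  | zero => simp
  | tmul u v =>
    simp only [cutForm_tmul, one_mul, mul_one, hform, Algebra.TensorProduct.tmul_mul_tmul,
      tensorTrace_tmul, ← Finset.sum_sub_distrib, ← Finset.sum_neg_distrib]
    refine Finset.sum_congr rfl fun j _ => ?_
    rw [mul_assoc z, hτ.tracial z, ← mul_assoc v, hτ.tracial _ z, mul_assoc, mul_assoc z]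
    ring
  | add x y hx hy =>
    rw [map_add, neg_add, ← hx, ← hy, ← Finset.sum_add_distrib]
    refine Finset.sum_congr rfl fun j _ => ?_
    simp only [mul_add, add_mul, map_add]
    ring

theorem map_averagedCommutator_mul (hE : IsCondExp D E) (hEτ : ∀ x, τ (E x) = τ x)
    (hτ : IsFaithfulTracialState τ) (hJ : ConjugateEquations τ D Z J) {n : ℕ}
    {e f : Fin n → M} (he : ∀ j, e j ∈ D) (hf : ∀ j, f j ∈ D)
    (hef : ∀ x, E x = ∑ j, τ (f j * x) • e j) {w : M} {t : Fin N → M ⊗[ℂ] M}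
    (ht : IsDiff D Z w t) :
    τ (averagedCommutator Z J ty e f * w) = -totalCut τ E Z ty 1 1 t := by
  rw [averagedCommutator, totalCut, Finset.sum_mul, map_sum, ← Finset.sum_neg_distrib]
  refine Finset.sum_congr rfl fun i _ => ?_
  rw [← cutForm_one_one_eq hE hEτ hτ hef, Finset.sum_mul, map_sum]
  refine Finset.sum_congr rfl fun j _ => ?_
  have h1 := hJ.map_mul ((IsDiff.coeff (he j)).mul (ht.mul ((IsDiff.coeff (hf j)).mul (.gen i)))) i
  have h2 := hJ.map_mul (((IsDiff.gen i).mul (.coeff (he j))).mul (ht.mul (.coeff (hf j)))) i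
  simp only [Pi.zero_apply, zero_mul, zero_add, if_true, Algebra.TensorProduct.tmul_mul_tmul,
    one_mul, mul_one, mul_add, map_add, tensorTrace_tmul, hτ.unital, mul_zero, add_zero]
    at h1 h2
  have e1 : τ (f j * (Z i * J i - J i * Z i) * e j * w) =
      τ (J i * (e j * (w * (f j * Z i)))) - τ (J i * (Z i * e j * (w * f j))) := by
    rw [mul_sub, sub_mul, sub_mul, map_sub]
    congr 1
    · rw [show f j * (Z i * J i) * e j * w = (f j * Z i) * (J i * (e j * w)) by
        simp only [mul_assoc], hτ.tracial]
      simp only [mul_assoc]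
    · rw [show f j * (J i * Z i) * e j * w = f j * (J i * Z i * e j * w) by
        simp only [mul_assoc], hτ.tracial]
      simp only [mul_assoc]
  rw [e1, h1, h2]
  ring

end Blocks

section AlternatingProducts

variable {τ : M →ₗ[ℂ] ℂ} {D : Subalgebra ℂ M} {E : M →ₗ[ℂ] M} {S : Bool → Subalgebra ℂ M}

/-- An alternating list of centered elements of the algebras `S true` and `S false`. -/
def IsAlternating (S : Bool → Subalgebra ℂ M) (E : M →ₗ[ℂ] M) (l : List (Bool × M)) : Prop :=
  l.IsChain (fun x y => x.1 ≠ y.1) ∧ ∀ x ∈ l, x.2 ∈ S x.1 ∧ E x.2 = 0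

/-- The product of the elements of a coloured list. -/
def colouredProd (l : List (Bool × M)) : M := (l.map Prod.snd).prod

@[simp]
theorem colouredProd_nil : colouredProd ([] : List (Bool × M)) = 1 := rfl

@[simp]
theorem colouredProd_cons (x : Bool × M) (l : List (Bool × M)) :
    colouredProd (x :: l) = x.2 * colouredProd l := by
  simp [colouredProd]

@[simp]
theorem colouredProd_append (l l' : List (Bool × M)) :
    colouredProd (l ++ l') = colouredProd l * colouredProd l' := by
  simp [colouredProd]

theorem isAlternating_nil : IsAlternating S E [] := ⟨.nil, by simp⟩

theorem isAlternating_cons {x : Bool × M} {l : List (Bool × M)} :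
    IsAlternating S E (x :: l) ↔
      (x.2 ∈ S x.1 ∧ E x.2 = 0) ∧ (∀ y ∈ l.head?, x.1 ≠ y.1) ∧ IsAlternating S E l := by
  simp only [IsAlternating, List.isChain_cons, List.forall_mem_cons]
  tauto

theorem isAlternating_append {l l' : List (Bool × M)} :
    IsAlternating S E (l ++ l') ↔ IsAlternating S E l ∧ IsAlternating S E l' ∧
      ∀ x ∈ l.getLast?, ∀ y ∈ l'.head?, x.1 ≠ y.1 := by
  simp only [IsAlternating, List.isChain_append, List.forall_mem_append]
  tauto

theorem mem_ite_coe_iff {f : Bool} {a : M} :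
    a ∈ (if f = true then (S true : Set M) else (S false : Set M)) ↔ a ∈ S f := by
  cases f <;> simp

theorem isFreeWithAmalgamation_iff :
    IsFreeWithAmalgamation E (S true : Set M) (S false : Set M) ↔
      ∀ l, IsAlternating S E l → l ≠ [] → E (colouredProd l) = 0 := by
  constructor
  · intro h l hl hne
    have := h l.length (List.length_pos_of_ne_nil hne) (fun j => l[j].2) (fun j => l[j].1)
      (fun j => mem_ite_coe_iff.2 (hl.2 l[j] (List.getElem_mem _)).1)
      (fun j => (hl.2 l[j] (List.getElem_mem _)).2)
      (fun j hj => List.isChain_iff_getElem.1 hl.1 j hj)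
    have e : List.ofFn (fun j : Fin l.length => l[j].2) = l.map Prod.snd := by
      apply List.ext_getElem <;> simp
    rwa [e] at this
  · intro h k hk a f ha hE hf
    have := h (List.ofFn fun j => (f j, a j)) ⟨List.isChain_ofFn.2 hf, by
      simp only [List.forall_mem_ofFn_iff]
      intro j
      exact ⟨mem_ite_coe_iff.1 (ha j), hE j⟩⟩ (by simpa [List.ofFn_eq_nil_iff] using hk.ne')
    simpa [colouredProd, List.map_ofFn, Function.comp_def] using this

theorem IsAlternating.cons_coeff_mul (hS : ∀ f, D ≤ S f) (hE : IsCondExp D E) {d : M}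
    (hd : d ∈ D) {x : Bool × M} {l : List (Bool × M)} (h : IsAlternating S E (x :: l)) :
    IsAlternating S E ((x.1, d * x.2) :: l) := by
  rw [isAlternating_cons] at h ⊢
  refine ⟨⟨mul_mem (hS _ hd) h.1.1, ?_⟩, h.2⟩
  rw [hE.map_coeff_mul hd, h.1.2, mul_zero]

theorem IsAlternating.cons_centered (hS : ∀ f, D ≤ S f) (hE : IsCondExp D E) {g : Bool} {a : M}
    (ha : a ∈ S g) {l : List (Bool × M)} (hl : IsAlternating S E l)
    (h : ∀ y ∈ l.head?, g ≠ y.1) : IsAlternating S E ((g, a - E a) :: l) :=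
  isAlternating_cons.2 ⟨⟨sub_mem ha (hS _ (hE.2.1 a)), hE.map_sub_self a⟩, h, hl⟩

theorem condExp_colouredProd_eq_zero (hS : ∀ f, D ≤ S f) (hE : IsCondExp D E)
    (hEτ : ∀ x, τ (E x) = τ x) (hτ : IsFaithfulTracialState τ) (hD : ∀ d ∈ D, star d ∈ D)
    {k : ℕ} (H : ∀ l, IsAlternating S E l → l ≠ [] → l.length < k → τ (colouredProd l) = 0)
    {l : List (Bool × M)} (hl : IsAlternating S E l) (hne : l ≠ []) (hk : l.length < k) :
    E (colouredProd l) = 0 := by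
  refine hE.eq_zero_of_trace hEτ hτ hD fun d hd => ?_
  obtain ⟨x, l, rfl⟩ := List.exists_cons_of_ne_nil hne
  have := H _ (hl.cons_coeff_mul hS hE hd) (List.cons_ne_nil _ _) (by simpa using hk)
  simpa [mul_assoc] using this

end AlternatingProducts

section AdditivityImpliesFreeness

variable {τ : M →ₗ[ℂ] ℂ} {D : Subalgebra ℂ M} {E : M →ₗ[ℂ] M} {N : ℕ} {Z J : Fin N → M}
  {ty : Fin N → Bool}

theorem averagedCommutator_eq_zero (hE : IsCondExp D E) (hEτ : ∀ x, τ (E x) = τ x)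
    (hτ : IsFaithfulTracialState τ) (hD : ∀ d ∈ D, star d ∈ D) (hZ : ∀ i, IsSelfAdjoint (Z i))
    (hJ : ConjugateEquations τ D Z J)
    (hcl : ∀ i, ty i = true → ∀ x, (∀ a ∈ blockAlgebra D Z ty true, τ (x * a) = 0) →
      τ (x * J i) = 0)
    {n : ℕ} {e f : Fin n → M} (he : ∀ j, e j ∈ D) (hf : ∀ j, f j ∈ D)
    (hef : ∀ x, E x = ∑ j, τ (f j * x) • e j) : averagedCommutator Z J ty e f = 0 := by
  set ξ := averagedCommutator Z J ty e f
  have h0 : ∀ a ∈ blockAlgebra D Z ty true, τ (ξ * a) = 0 := by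
    intro a ha
    obtain ⟨t, ht, -, -, h⟩ := exists_isDiff_block (τ := τ) hE ha
    rw [map_averagedCommutator_mul hE hEτ hτ hJ he hf hef ht, h]
    simp [hE.1]
  have h1 : ∀ a ∈ blockAlgebra D Z ty true, τ (star ξ * a) = 0 := by
    intro a ha
    rw [hτ.tracial, ← star_star a, ← star_mul, hτ.map_star,
      h0 _ (star_mem_blockAlgebra hD hZ ha), map_zero]
  refine hτ.faithful _ ?_
  change τ (star ξ * ∑ i with ty i = true, ∑ j, f j * (Z i * J i - J i * Z i) * e j) = 0
  rw [Finset.mul_sum, map_sum]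
  refine Finset.sum_eq_zero fun i hi => ?_
  have hi : ty i = true := by simpa using hi
  rw [Finset.mul_sum, map_sum]
  refine Finset.sum_eq_zero fun j _ => ?_
  have e1 : τ (star ξ * (f j * (Z i * J i - J i * Z i) * e j)) =
      τ ((e j * star ξ * f j * Z i - Z i * e j * star ξ * f j) * J i) := by
    rw [mul_sub, sub_mul, sub_mul, mul_sub, map_sub, map_sub]
    congr 1
    · rw [← mul_assoc, hτ.tracial]
      simp only [mul_assoc]
    · rw [show star ξ * (f j * (J i * Z i) * e j) = star ξ * f j * J i * (Z i * e j) by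
        simp only [mul_assoc], hτ.tracial]
      simp only [mul_assoc]
  rw [e1]
  refine hcl i hi _ fun a ha => ?_
  have hZi : Z i ∈ blockAlgebra D Z ty true := hi ▸ gen_mem_blockAlgebra i
  have hej := coeff_le_blockAlgebra (Z := Z) (ty := ty) true (he j)
  have hfj := coeff_le_blockAlgebra (Z := Z) (ty := ty) true (hf j)
  have e2 : τ (e j * star ξ * f j * Z i * a) = τ (star ξ * (f j * Z i * a * e j)) := by
    rw [show e j * star ξ * f j * Z i * a = e j * (star ξ * f j * Z i * a) by
      simp only [mul_assoc], hτ.tracial]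
    simp only [mul_assoc]
  have e3 : τ (Z i * e j * star ξ * f j * a) = τ (star ξ * (f j * a * (Z i * e j))) := by
    rw [show Z i * e j * star ξ * f j * a = Z i * e j * (star ξ * f j * a) by
      simp only [mul_assoc], hτ.tracial]
    simp only [mul_assoc]
  rw [sub_mul, map_sub, e2, e3, h1 _ (mul_mem (mul_mem (mul_mem hfj hZi) ha) hej),
    h1 _ (mul_mem (mul_mem hfj ha) (mul_mem hZi hej)), sub_zero]

theorem exists_isDiff_colouredProd (hE : IsCondExp D E) {k : ℕ}
    (H : ∀ l, IsAlternating (blockAlgebra D Z ty) E l → l ≠ [] → l.length < k →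
      E (colouredProd l) = 0)
    {l : List (Bool × M)} (hl : IsAlternating (blockAlgebra D Z ty) E l) (hk : l.length < k)
    (hlast : ∀ x ∈ l.getLast?, x.1 = false) :
    ∃ t, IsDiff D Z (colouredProd l) t ∧ ∀ p, totalCut τ E Z ty p 1 t = 0 := by
  induction l with
  | nil => exact ⟨0, .coeff (one_mem D), fun p => by simp [totalCut]⟩
  | cons c l ih =>
    have hl' := isAlternating_cons.1 hl
    have hlast' : ∀ x ∈ l.getLast?, x.1 = false := by
      intro x hx
      exact hlast x (List.mem_getLast?_cons hx)
    obtain ⟨t', ht', h'⟩ := ih hl'.2.2 (by simp at hk; omega) hlast'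
    obtain ⟨t, ht, -, -, h⟩ := exists_isDiff_block (τ := τ) hE hl'.1.1
    refine ⟨_, colouredProd_cons c l ▸ ht.mul ht', fun p => ?_⟩
    rw [totalCut_mul, h', h, add_zero, mul_one, ← colouredProd_cons]
    split_ifs with hc
    · have hne : l ≠ [] := by
        rintro rfl
        simp [hc] at hlast
      rw [H _ hl'.2.2 hne (by simp at hk; omega), H _ hl (List.cons_ne_nil _ _) hk]
      simp
    · rfl

theorem map_colouredProd_eq_zero (hE : IsCondExp D E) (hEτ : ∀ x, τ (E x) = τ x)
    (hτ : IsFaithfulTracialState τ) (hD : ∀ d ∈ D, star d ∈ D)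
    (hcut : ∀ w t, IsDiff D Z w t → totalCut τ E Z ty 1 1 t = 0) (k : ℕ) :
    ∀ l, IsAlternating (blockAlgebra D Z ty) E l → l ≠ [] → l.length < k →
      τ (colouredProd l) = 0 := by
  induction k with
  | zero => intro l _ _ h; simp at h
  | succ k ih =>
    have H : ∀ l, IsAlternating (blockAlgebra D Z ty) E l → l ≠ [] → l.length < k →
        E (colouredProd l) = 0 := fun l hl hne hk =>
      condExp_colouredProd_eq_zero coeff_le_blockAlgebra hE hEτ hτ hD ih hl hne hk
    have core : ∀ c l, IsAlternating (blockAlgebra D Z ty) E (c :: l) → l ≠ [] →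
        l.length < k → c.1 = true → (∀ x ∈ l.getLast?, x.1 = false) →
        τ (colouredProd (c :: l)) = 0 := by
      intro c l hl hne hk hc hlast
      have hl' := isAlternating_cons.1 hl
      obtain ⟨t', ht', h'⟩ := exists_isDiff_colouredProd (τ := τ) hE H hl'.2.2 hk hlast
      obtain ⟨t, ht, -, -, h⟩ := exists_isDiff_block (τ := τ) hE hl'.1.1
      have := hcut _ _ (ht.mul ht')
      rw [totalCut_mul, h', h, if_pos hc] at this
      simp only [one_mul, mul_one, H l hl'.2.2 hne hk, hE.1, mul_zero, map_zero, hEτ, zero_sub,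
        add_zero, neg_eq_zero] at this
      rwa [colouredProd_cons]
    intro l hl hne hk
    obtain ⟨c, l, rfl⟩ := List.exists_cons_of_ne_nil hne
    obtain rfl | ⟨m, z, rfl⟩ := l.eq_nil_or_concat'
    · have := (hl.2 c (by simp)).2
      rw [colouredProd_cons, colouredProd_nil, mul_one, ← hEτ, this, map_zero]
    · rw [← List.cons_append] at hl
      have hl2 := isAlternating_append.1 hl
      have hz := (isAlternating_cons.1 hl2.2.1).1
      have hc := isAlternating_cons.1 hl2.1
      have hzl : ∀ x ∈ (c :: m).getLast?, x.1 ≠ z.1 := fun x hx => hl2.2.2 x hx z (by simp)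
      have hlen : m.length + 1 < k := by simp at hk; omega
      have hrot : τ (colouredProd (c :: (m ++ [z]))) = τ (colouredProd (z :: c :: m)) := by
        simp only [colouredProd_cons, colouredProd_append, colouredProd_nil, mul_one]
        rw [← mul_assoc, hτ.tracial]
      by_cases heq : z.1 = c.1
      · have hm : m ≠ [] := by
          rintro rfl
          exact hzl c (by simp) heq.symm
        have hzc : z.2 * c.2 ∈ blockAlgebra D Z ty c.1 := mul_mem (heq ▸ hz.1) hc.1.1
        have h1 := ih _ (hc.2.2.cons_centered coeff_le_blockAlgebra hE hzc hc.2.1)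
          (List.cons_ne_nil _ _) (by simpa using hlen)
        have h2 : τ (E (z.2 * c.2) * colouredProd m) = 0 := by
          rw [← hE.trace_mul' hEτ, H m hc.2.2 hm (by omega), mul_zero, map_zero]
        rw [colouredProd_cons, sub_mul, map_sub, h2, sub_zero] at h1
        rw [hrot]
        simpa [mul_assoc] using h1
      · have hrotalt : IsAlternating (blockAlgebra D Z ty) E (z :: c :: m) :=
          isAlternating_cons.2 ⟨hz, by simpa using heq, hl2.1⟩
        cases hcz : c.1 with
        | true =>
          have hz' : z.1 = false := by simpa [hcz] using heq
          exact core c _ hl (by simp) (by simpa using hlen) hcz (by simpa using hz')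
        | false =>
          have hz' : z.1 = true := by simpa [hcz] using heq
          rw [hrot]
          exact core z _ hrotalt (by simp) (by simpa using hlen) hz'
            fun x hx => by simpa [hz'] using hzl x hx

theorem isFreeWithAmalgamation_of_memL2Closure [FiniteDimensional ℂ D] (hE : IsCondExp D E)
    (hEτ : ∀ x, τ (E x) = τ x) (hτ : IsFaithfulTracialState τ) (hD : ∀ d ∈ D, star d ∈ D)
    (hZ : ∀ i, IsSelfAdjoint (Z i)) (hJ : ConjugateEquations τ D Z J)
    (hcl : ∀ i, ty i = true → ∀ x, (∀ a ∈ blockAlgebra D Z ty true, τ (x * a) = 0) →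
      τ (x * J i) = 0) :
    IsFreeWithAmalgamation E (blockAlgebra D Z ty true : Set M)
      (blockAlgebra D Z ty false : Set M) := by
  obtain ⟨n, e, f, he, hf, hef⟩ := hE.exists_dual_basis hEτ hτ hD
  have hξ := averagedCommutator_eq_zero hE hEτ hτ hD hZ hJ hcl he hf hef
  have hcut : ∀ w t, IsDiff D Z w t → totalCut τ E Z ty 1 1 t = 0 := by
    intro w t ht
    have := map_averagedCommutator_mul (ty := ty) hE hEτ hτ hJ he hf hef ht
    rw [hξ, zero_mul, map_zero] at this
    exact neg_eq_zero.1 this.symm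
  rw [isFreeWithAmalgamation_iff (S := blockAlgebra D Z ty)]
  intro l hl hne
  exact condExp_colouredProd_eq_zero coeff_le_blockAlgebra hE hEτ hτ hD
    (map_colouredProd_eq_zero hE hEτ hτ hD hcut (l.length + 1)) hl hne (Nat.lt_succ_self _)

end AdditivityImpliesFreeness

section MixedProducts

variable {τ : M →ₗ[ℂ] ℂ} {D : Subalgebra ℂ M} {E : M →ₗ[ℂ] M} {S : Bool → Subalgebra ℂ M}

/-- A nonempty alternating list that is not a single element of colour `g`. -/
def IsMixed (S : Bool → Subalgebra ℂ M) (E : M →ₗ[ℂ] M) (g : Bool) (l : List (Bool × M)) :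
    Prop :=
  IsAlternating S E l ∧ l ≠ [] ∧ ∀ c, l = [c] → c.1 ≠ g

theorem condExp_mul_colouredProd_eq_zero_of_head (hS : ∀ f, D ≤ S f) (hE : IsCondExp D E)
    (H : ∀ l, IsAlternating S E l → l ≠ [] → E (colouredProd l) = 0) {g : Bool} {a : M}
    (ha : a ∈ S g) {l : List (Bool × M)} (hl : IsAlternating S E l) (hne : l ≠ [])
    (h : ∀ y ∈ l.head?, g ≠ y.1) : E (a * colouredProd l) = 0 := by
  have h1 := H _ (hl.cons_centered hS hE ha h) (List.cons_ne_nil _ _)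
  rw [colouredProd_cons, sub_mul, map_sub, hE.map_coeff_mul (hE.2.1 a), H l hl hne, mul_zero,
    sub_zero] at h1
  exact h1

theorem condExp_mul_colouredProd_eq_zero (hS : ∀ f, D ≤ S f) (hE : IsCondExp D E)
    (H : ∀ l, IsAlternating S E l → l ≠ [] → E (colouredProd l) = 0) {g : Bool} {a : M}
    (ha : a ∈ S g) {l : List (Bool × M)} (hl : IsMixed S E g l) :
    E (a * colouredProd l) = 0 := by
  obtain ⟨hl, hne, hg⟩ := hl
  obtain ⟨c, l, rfl⟩ := List.exists_cons_of_ne_nil hne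
  have hl' := isAlternating_cons.1 hl
  by_cases hc : c.1 = g
  · subst hc
    rw [colouredProd_cons, ← mul_assoc]
    refine condExp_mul_colouredProd_eq_zero_of_head hS hE H (mul_mem ha hl'.1.1) hl'.2.2 ?_ hl'.2.1
    rintro rfl
    exact hg c rfl rfl
  · exact condExp_mul_colouredProd_eq_zero_of_head hS hE H ha hl hne (by simpa using Ne.symm hc)

/-- The span of the products of coefficients with alternating products. -/
def alternatingSpan (D : Subalgebra ℂ M) (S : Bool → Subalgebra ℂ M) (E : M →ₗ[ℂ] M) :
    Submodule ℂ M :=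
  Submodule.span ℂ {x | ∃ d ∈ D, ∃ l, IsAlternating S E l ∧ x = d * colouredProd l}

/-- The span of the mixed alternating products. -/
def mixedSpan (S : Bool → Subalgebra ℂ M) (E : M →ₗ[ℂ] M) (g : Bool) : Submodule ℂ M :=
  Submodule.span ℂ {x | ∃ l, IsMixed S E g l ∧ x = colouredProd l}

theorem mul_colouredProd_mem_alternatingSpan (hS : ∀ f, D ≤ S f) (hE : IsCondExp D E) {g : Bool}
    {a : M} (ha : a ∈ S g) {l : List (Bool × M)} (hl : IsAlternating S E l) :
    a * colouredProd l ∈ alternatingSpan D S E := by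
  have key : ∀ a ∈ S g, ∀ l, IsAlternating S E l → (∀ y ∈ l.head?, g ≠ y.1) →
      a * colouredProd l ∈ alternatingSpan D S E := by
    intro a ha l hl h
    have h1 : E a * colouredProd l ∈ alternatingSpan D S E :=
      Submodule.subset_span ⟨E a, hE.2.1 a, l, hl, rfl⟩
    have h2 : 1 * colouredProd ((g, a - E a) :: l) ∈ alternatingSpan D S E :=
      Submodule.subset_span ⟨1, one_mem D, _, hl.cons_centered hS hE ha h, rfl⟩
    have e : a * colouredProd l = E a * colouredProd l + 1 * colouredProd ((g, a - E a) :: l) := by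
      rw [colouredProd_cons]; noncomm_ring
    exact e ▸ add_mem h1 h2
  cases l with
  | nil => exact key a ha [] hl (by simp)
  | cons c l =>
    have hl' := isAlternating_cons.1 hl
    by_cases hc : c.1 = g
    · subst hc
      rw [colouredProd_cons, ← mul_assoc]
      exact key _ (mul_mem ha hl'.1.1) l hl'.2.2 hl'.2.1
    · exact key a ha _ hl (by simpa using Ne.symm hc)

theorem mul_mem_alternatingSpan (hS : ∀ f, D ≤ S f) (hE : IsCondExp D E) {g : Bool}
    {a : M} (ha : a ∈ S g) {x : M} (hx : x ∈ alternatingSpan D S E) :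
    a * x ∈ alternatingSpan D S E := by
  induction hx using Submodule.span_induction with
  | mem x h =>
    obtain ⟨d, hd, l, hl, rfl⟩ := h
    rw [← mul_assoc]
    exact mul_colouredProd_mem_alternatingSpan hS hE (mul_mem ha (hS g hd)) hl
  | zero => simp
  | add x y _ _ hx hy => rw [mul_add]; exact add_mem hx hy
  | smul r x _ hx => rw [mul_smul_comm]; exact Submodule.smul_mem _ r hx

theorem alternatingSpan_le (hS : ∀ f, D ≤ S f) (hE : IsCondExp D E) (g : Bool) :
    alternatingSpan D S E ≤ Subalgebra.toSubmodule (S g) ⊔ mixedSpan S E g := by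
  refine Submodule.span_le.2 ?_
  rintro _ ⟨d, hd, l, hl, rfl⟩
  cases l with
  | nil => exact Submodule.mem_sup_left (by simpa using hS g hd)
  | cons c l =>
    have e : d * colouredProd (c :: l) = colouredProd ((c.1, d * c.2) :: l) := by
      simp [mul_assoc]
    have hl' := hl.cons_coeff_mul hS hE hd
    rw [e]
    by_cases h : l = [] ∧ c.1 = g
    · obtain ⟨rfl, rfl⟩ := h
      exact Submodule.mem_sup_left (by simpa using (isAlternating_cons.1 hl').1.1)
    · refine Submodule.mem_sup_right
        (Submodule.subset_span ⟨_, ⟨hl', List.cons_ne_nil _ _, ?_⟩, rfl⟩)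
      rintro x hx hxg
      obtain ⟨rfl, rfl⟩ := List.cons.inj hx
      exact h ⟨rfl, hxg⟩

end MixedProducts

section FreenessImpliesAdditivity

variable {τ : M →ₗ[ℂ] ℂ} {D : Subalgebra ℂ M} {E : M →ₗ[ℂ] M} {N : ℕ} {Z J : Fin N → M}
  {ty : Fin N → Bool}

theorem mem_alternatingSpan_of_mem_sup (hE : IsCondExp D E) {w : M}
    (hw : w ∈ D ⊔ Algebra.adjoin ℂ (Set.range Z)) :
    w ∈ alternatingSpan D (blockAlgebra D Z ty) E := by
  rw [← adjoin_coeff_union] at hw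
  have key : ∀ x ∈ alternatingSpan D (blockAlgebra D Z ty) E,
      w * x ∈ alternatingSpan D (blockAlgebra D Z ty) E := by
    induction hw using Algebra.adjoin_induction with
    | mem w h =>
      intro x hx
      obtain h | ⟨k, rfl⟩ := h
      · exact mul_mem_alternatingSpan coeff_le_blockAlgebra hE (coeff_le_blockAlgebra true h) hx
      · exact mul_mem_alternatingSpan coeff_le_blockAlgebra hE (gen_mem_blockAlgebra k) hx
    | algebraMap r =>
      intro x hx
      rw [← Algebra.smul_def]
      exact Submodule.smul_mem _ r hx
    | add w w' _ _ h h' => intro x hx; rw [add_mul]; exact add_mem (h x hx) (h' x hx)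
    | mul w w' _ _ h h' => intro x hx; rw [mul_assoc]; exact h _ (h' x hx)
  simpa using key 1 (Submodule.subset_span ⟨1, one_mem D, [], isAlternating_nil, by simp⟩)

theorem exists_isDiff_colouredProd_tail (hE : IsCondExp D E) {l : List (Bool × M)}
    (hl : ∀ x ∈ l, x.2 ∈ blockAlgebra D Z ty x.1) :
    ∃ t, IsDiff D Z (colouredProd l) t ∧ ∀ i p q,
      (∀ l₁ c l₂, l = l₁ ++ c :: l₂ → ∀ v ∈ blockAlgebra D Z ty c.1,
        τ (v * colouredProd l₂ * q) = 0) →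
      tensorTrace τ ((p ⊗ₜ 1) * (t i * (1 ⊗ₜ q))) = 0 := by
  induction l with
  | nil => exact ⟨0, .coeff (one_mem D), fun i p q _ => by simp⟩
  | cons c l ih =>
    obtain ⟨t', ht', h'⟩ := ih fun x hx => hl x (List.mem_cons_of_mem _ hx)
    obtain ⟨t, ht, h, -, -⟩ := exists_isDiff_block (τ := τ) hE (hl c (by simp))
    refine ⟨_, colouredProd_cons c l ▸ ht.mul ht', fun i p q hq => ?_⟩
    have h1 := h i (tensorTrace τ ∘ₗ LinearMap.mulLeft ℂ (p ⊗ₜ[ℂ] (1 : M)) ∘ₗ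
      LinearMap.mulRight ℂ ((1 : M) ⊗ₜ[ℂ] (colouredProd l * q))) fun u _ v hv => by
        have := hq [] c l rfl v hv
        simp [← mul_assoc, this]
    have h2 := h' i (p * c.2) q fun l₁ c' l₂ e => hq (c :: l₁) c' l₂ (by rw [e, List.cons_append])
    simp only [LinearMap.comp_apply, LinearMap.mulRight_apply, LinearMap.mulLeft_apply] at h1
    have e : (p ⊗ₜ[ℂ] (1 : M)) * ((t i * (1 ⊗ₜ colouredProd l) + (c.2 ⊗ₜ 1) * t' i) * (1 ⊗ₜ q)) =
        (p ⊗ₜ 1) * (t i * (1 ⊗ₜ (colouredProd l * q))) +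
          ((p * c.2) ⊗ₜ 1) * (t' i * (1 ⊗ₜ q)) := by
      rw [add_mul, mul_add, mul_assoc (t i), Algebra.TensorProduct.tmul_mul_tmul, one_mul,
        mul_assoc (c.2 ⊗ₜ[ℂ] (1 : M)), ← mul_assoc (p ⊗ₜ[ℂ] (1 : M)) (c.2 ⊗ₜ[ℂ] (1 : M)),
        Algebra.TensorProduct.tmul_mul_tmul, mul_one]
    rw [e, map_add, h1, h2, add_zero]

theorem ConjugateEquations.map_mul_colouredProd_eq_zero (hE : IsCondExp D E)
    (hEτ : ∀ x, τ (E x) = τ x) (hτ : IsFaithfulTracialState τ) (hJ : ConjugateEquations τ D Z J)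
    (H : ∀ l, IsAlternating (blockAlgebra D Z ty) E l → l ≠ [] → E (colouredProd l) = 0)
    {i : Fin N} {l : List (Bool × M)} (hl : IsMixed (blockAlgebra D Z ty) E (ty i) l) :
    τ (J i * colouredProd l) = 0 := by
  obtain ⟨hl, hne, hi⟩ := hl
  obtain rfl | ⟨l, c, rfl⟩ := l.eq_nil_or_concat'
  · exact absurd rfl hne
  obtain ⟨hl0, hc, hlc⟩ := isAlternating_append.1 hl
  have hc' := (isAlternating_cons.1 hc).1
  obtain ⟨t, ht, h⟩ := exists_isDiff_colouredProd_tail (τ := τ) hE fun x hx => (hl0.2 x hx).1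
  obtain ⟨t', ht', h1, h2, -⟩ := exists_isDiff_block (τ := τ) hE hc'.1
  rw [colouredProd_append, colouredProd_cons, colouredProd_nil, mul_one,
    hJ.map_mul (ht.mul ht'), map_add]
  have e1 : tensorTrace τ (t i * (1 ⊗ₜ c.2)) = 0 := by
    have := h i 1 c.2 ?_
    · rwa [← Algebra.TensorProduct.one_def, one_mul] at this
    · rintro l₁ c₀ l₂ rfl v hv
      rw [List.append_assoc, List.cons_append] at hl
      obtain ⟨-, h3, h4⟩ := isAlternating_cons.1 (isAlternating_append.1 hl).2.1
      have := condExp_mul_colouredProd_eq_zero_of_head coeff_le_blockAlgebra hE H hv h4 (by simp) h3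
      rw [← hEτ, mul_assoc]
      simpa using congrArg τ this
  have e2 : tensorTrace τ ((colouredProd l ⊗ₜ 1) * t' i) = 0 := by
    by_cases hci : ty i = c.1
    · have := h1 i (tensorTrace τ ∘ₗ LinearMap.mulLeft ℂ (colouredProd l ⊗ₜ[ℂ] (1 : M))) ?_
      · simpa using this
      · intro u hu v _
        have hm : IsMixed (blockAlgebra D Z ty) E c.1 l := by
          refine ⟨hl0, ?_, ?_⟩
          · rintro rfl
            exact hi c rfl hci.symm
          · rintro c' rfl
            exact hlc c' (by simp) c (by simp)
        have h5 := condExp_mul_colouredProd_eq_zero coeff_le_blockAlgebra hE H hu hm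
        have h6 : τ (colouredProd l * u) = 0 := by
          rw [hτ.tracial, ← hEτ, h5, map_zero]
        simp [h6]
    · rw [h2 i hci, mul_zero, map_zero]
  rw [e1, e2, add_zero]

theorem MemL2Closure.of_isFreeWithAmalgamation (hE : IsCondExp D E) (hEτ : ∀ x, τ (E x) = τ x)
    (hτ : IsFaithfulTracialState τ) (hD : ∀ d ∈ D, star d ∈ D) (hZ : ∀ i, IsSelfAdjoint (Z i))
    (hJ : ConjugateEquations τ D Z J)
    (hfree : IsFreeWithAmalgamation E (blockAlgebra D Z ty true : Set M)
      (blockAlgebra D Z ty false : Set M)) {i : Fin N}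
    (hcl : MemL2Closure τ ((D : Set M) ∪ Set.range Z) (J i)) :
    MemL2Closure τ ((D : Set M) ∪ Z '' {k | ty k = ty i}) (J i) := by
  have H := (isFreeWithAmalgamation_iff (S := blockAlgebra D Z ty)).1 hfree
  have hstar : ∀ x ∈ (D : Set M) ∪ Z '' {k | ty k = ty i},
      star x ∈ (D : Set M) ∪ Z '' {k | ty k = ty i} := by
    rintro x (hx | ⟨k, hk, rfl⟩)
    · exact Or.inl (hD x hx)
    · exact Or.inr ⟨k, hk, (hZ k).star_eq.symm⟩
  intro ε hε
  obtain ⟨w, hw, hlt⟩ := hcl ε hε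
  rw [mem_adjoin_coeff_union_star_iff hD hZ] at hw
  obtain ⟨a, ha, b, hb, hab⟩ := Submodule.mem_sup.1 (alternatingSpan_le coeff_le_blockAlgebra hE
    (ty i) (mem_alternatingSpan_of_mem_sup (ty := ty) hE (star_mem_sup_adjoin_range hD hZ hw)))
  have ha' := star_mem_blockAlgebra hD hZ (show a ∈ blockAlgebra D Z ty (ty i) from ha)
  refine ⟨star a, ?_, lt_of_le_of_lt ?_ hlt⟩
  · rwa [union_star_image_eq hstar, adjoin_coeff_union]
  · have hwab : w = star a + star b := by rw [← star_add, hab, star_star]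
    rw [hwab]
    refine l2Dist_le_of_orthogonal hτ ?_
    rw [star_star]
    clear hab hwab
    induction hb using Submodule.span_induction with
    | mem x h =>
      obtain ⟨l, hl, rfl⟩ := h
      rw [sub_mul, map_sub, hJ.map_mul_colouredProd_eq_zero hE hEτ hτ H hl, ← hEτ (star a * _),
        condExp_mul_colouredProd_eq_zero coeff_le_blockAlgebra hE H ha' hl, map_zero, sub_zero]
    | zero => simp
    | add x y _ _ hx hy => rw [mul_add, map_add, hx, hy, add_zero]
    | smul r x _ hx => rw [mul_smul_comm, map_smul, hx, smul_zero]

end FreenessImpliesAdditivity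

section Append

variable {τ : M →ₗ[ℂ] ℂ} {D : Subalgebra ℂ M} {m n : ℕ} {X : Fin m → M} {Y : Fin n → M}

/-- The colouring of the concatenation of two families. -/
def appendColour (m n : ℕ) : Fin (m + n) → Bool :=
  Fin.append (fun _ : Fin m => true) (fun _ : Fin n => false)

@[simp]
theorem appendColour_castAdd (i : Fin m) : appendColour m n (Fin.castAdd n i) = true := by
  simp [appendColour]

@[simp]
theorem appendColour_natAdd (i : Fin n) : appendColour m n (Fin.natAdd m i) = false := by
  simp [appendColour]

theorem append_image_true :
    Fin.append X Y '' {k | appendColour m n k = true} = Set.range X := by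
  ext x
  constructor
  · rintro ⟨k, hk, rfl⟩
    induction k using Fin.addCases with
    | left i => exact ⟨i, by simp⟩
    | right i => simp at hk
  · rintro ⟨i, rfl⟩
    exact ⟨Fin.castAdd n i, by simp, by simp⟩

theorem append_image_false :
    Fin.append X Y '' {k | appendColour m n k = false} = Set.range Y := by
  ext x
  constructor
  · rintro ⟨k, hk, rfl⟩
    induction k using Fin.addCases with
    | left i => simp at hk
    | right i => exact ⟨i, by simp⟩
  · rintro ⟨i, rfl⟩
    exact ⟨Fin.natAdd m i, by simp, by simp⟩

theorem ConjugateEquations.left {J : Fin (m + n) → M}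
    (hJ : ConjugateEquations τ D (Fin.append X Y) J) :
    ConjugateEquations τ D X (J ∘ Fin.castAdd n) := by
  have h := hJ.comp (Fin.castAdd_injective m n)
  rwa [show Fin.append X Y ∘ Fin.castAdd n = X by ext; simp] at h

theorem ConjugateEquations.right {J : Fin (m + n) → M}
    (hJ : ConjugateEquations τ D (Fin.append X Y) J) :
    ConjugateEquations τ D Y (J ∘ Fin.natAdd m) := by
  have h := hJ.comp (Fin.natAdd_injective n m)
  rwa [show Fin.append X Y ∘ Fin.natAdd m = Y by ext; simp] at h

/-- Additivity of the free Fisher information forces the conjugate variables of the first family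
to be those of the concatenation. -/
theorem IsConjugateSystem.left_eq_of_phiStar_eq_add (hτ : IsFaithfulTracialState τ)
    (hD : ∀ d ∈ D, star d ∈ D) (hX : ∀ i, IsSelfAdjoint (X i)) (hY : ∀ i, IsSelfAdjoint (Y i))
    (hZ : ∀ i, IsSelfAdjoint (Fin.append X Y i)) {J : Fin (m + n) → M} {JX : Fin m → M}
    {JY : Fin n → M} (hJ : IsConjugateSystem τ D (Fin.append X Y) J)
    (hJX : IsConjugateSystem τ D X JX) (hJY : IsConjugateSystem τ D Y JY)
    (h : phiStar τ D (Fin.append X Y) = phiStar τ D X + phiStar τ D Y) (i : Fin m) :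
    J (Fin.castAdd n i) = JX i := by
  have hpos := hτ.mul_self_re_nonneg
  rw [hJ.phiStar_eq hτ hD hZ, hJX.phiStar_eq hτ hD hX, hJY.phiStar_eq hτ hD hY,
    ← ENNReal.ofReal_add (Finset.sum_nonneg fun i _ => hpos _)
      (Finset.sum_nonneg fun i _ => hpos _),
    ENNReal.ofReal_eq_ofReal_iff (Finset.sum_nonneg fun i _ => hpos _)
      (add_nonneg (Finset.sum_nonneg fun i _ => hpos _) (Finset.sum_nonneg fun i _ => hpos _)),
    Fin.sum_univ_add] at h
  have hl : ∀ i, (τ (J (Fin.castAdd n i) * star (J (Fin.castAdd n i)))).re = _ :=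
    hJX.re_map_mul_star_eq_add hτ hD hX hJ.2.left
  have hr : ∀ i, (τ (J (Fin.natAdd m i) * star (J (Fin.natAdd m i)))).re = _ :=
    hJY.re_map_mul_star_eq_add hτ hD hY hJ.2.right
  simp only [hl, hr, Finset.sum_add_distrib] at h
  have h1 := Finset.sum_nonneg fun (i : Fin m) (_ : i ∈ Finset.univ) =>
    hpos (J (Fin.castAdd n i) - JX i)
  have h2 := Finset.sum_nonneg fun (i : Fin n) (_ : i ∈ Finset.univ) =>
    hpos (J (Fin.natAdd m i) - JY i)
  have h3 := (Finset.sum_eq_zero_iff_of_nonneg fun (i : Fin m) (_ : i ∈ Finset.univ) =>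
    hpos (J (Fin.castAdd n i) - JX i)).1 (by linarith) i (Finset.mem_univ i)
  exact sub_eq_zero.1 (hτ.eq_zero_of_re_eq_zero h3)

end Append

theorem fisher_information_additive_iff_free
    (τ : M →ₗ[ℂ] ℂ) (hτ : IsFaithfulTracialState τ)
    (D : Subalgebra ℂ M) [FiniteDimensional ℂ ↥D] (hDstar : ∀ d ∈ D, star d ∈ D)
    (ED : M →ₗ[ℂ] M) (hED : IsCondExp D ED) (hEDτ : ∀ x, τ (ED x) = τ x)
    {m n : ℕ} (X : Fin m → M) (Y : Fin n → M)
    (hX : ∀ i, IsSelfAdjoint (X i)) (hY : ∀ i, IsSelfAdjoint (Y i))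
    (hfin : phiStar τ D (Fin.append X Y) ≠ ⊤) :
    (phiStar τ D (Fin.append X Y) = phiStar τ D X + phiStar τ D Y ↔
      IsFreeWithAmalgamation ED
        ((D ⊔ Algebra.adjoin ℂ (Set.range X) : Subalgebra ℂ M) : Set M)
        ((D ⊔ Algebra.adjoin ℂ (Set.range Y) : Subalgebra ℂ M) : Set M)) := by

  have hZ : ∀ i, IsSelfAdjoint (Fin.append X Y i) := by
    intro i
    induction i using Fin.addCases with
    | left i => simpa using hX i
    | right i => simpa using hY i
  obtain ⟨J, hJ⟩ := exists_isConjugateSystem_of_phiStar_ne_top hfin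
  rw [← append_image_true (X := X) (Y := Y), ← append_image_false (X := X) (Y := Y)]
  change _ ↔ IsFreeWithAmalgamation ED
    (blockAlgebra D (Fin.append X Y) (appendColour m n) true : Set M)
    (blockAlgebra D (Fin.append X Y) (appendColour m n) false : Set M)
  constructor
  · intro h
    rw [h, ENNReal.add_ne_top] at hfin
    obtain ⟨JX, hJX⟩ := exists_isConjugateSystem_of_phiStar_ne_top hfin.1
    obtain ⟨JY, hJY⟩ := exists_isConjugateSystem_of_phiStar_ne_top hfin.2
    refine isFreeWithAmalgamation_of_memL2Closure hED hEDτ hτ hDstar hZ hJ.2 fun i hi x hx => ?_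
    induction i using Fin.addCases with
    | left i =>
      rw [hJ.left_eq_of_phiStar_eq_add hτ hDstar hX hY hZ hJX hJY h]
      refine (hJX.1 i).map_mul_eq_zero hτ fun a ha => hx a ?_
      rwa [mem_adjoin_coeff_union_star_iff hDstar hX,
        ← append_image_true (X := X) (Y := Y)] at ha
    | right i => simp at hi
  · intro h
    have hcl := fun i => (hJ.1 i).of_isFreeWithAmalgamation hED hEDτ hτ hDstar hZ hJ.2 h
    have hJX : IsConjugateSystem τ D X (J ∘ Fin.castAdd n) := by
      refine ⟨fun i => ?_, hJ.2.left⟩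
      have := hcl (Fin.castAdd n i)
      rwa [appendColour_castAdd, append_image_true] at this
    have hJY : IsConjugateSystem τ D Y (J ∘ Fin.natAdd m) := by
      refine ⟨fun i => ?_, hJ.2.right⟩
      have := hcl (Fin.natAdd m i)
      rwa [appendColour_natAdd, append_image_false] at this
    rw [hJ.phiStar_eq hτ hDstar hZ, hJX.phiStar_eq hτ hDstar hX, hJY.phiStar_eq hτ hDstar hY,
      Fin.sum_univ_add, ENNReal.ofReal_add
        (Finset.sum_nonneg fun i _ => hτ.mul_self_re_nonneg _)
        (Finset.sum_nonneg fun i _ => hτ.mul_self_re_nonneg _)]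
    rfl

end OVD
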